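/- For the Lie algebra 𝔤₄,₇, the almost Hermitian structure (J₁,g) belongs to the Gray–Hervella class W₄: for all x,y,z ∈ V, F₁(x,y,z) = ½{ g(x,y)θ₁(z) − g(x,J₁y)θ₁(J₁z) − g(x,z)θ₁(y) + g(x,J₁z)θ₁(J₁y) }, where the Lee form satisfies θ₁(e₂) = 1, θ₁(e₃) = 3, θ₁(e₁) = θ₁(e₄) = 0; moreover θ₁ ≠ 0, so the structure is not Kähler. -/

import Mathlib

noncomputable section

/-- The underlying 4-dimensional real vector space. -/
abbrev V : Type := Fin 4 → ℝ

/-- The standard basis e₁,e₂,e₃,e₄ (indexed by 0,1,2,3). -/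
def e (i : Fin 4) : V := Pi.single i 1

/-- The neutral metric g with g(e₁,e₁)=g(e₂,e₂)=1, g(e₃,e₃)=g(e₄,e₄)=−1. -/
def gm (x y : V) : ℝ := x 0 * y 0 + x 1 * y 1 - x 2 * y 2 - x 3 * y 3

/-- The signs ε₁=ε₂=1, ε₃=ε₄=−1. -/
def eps : Fin 4 → ℝ := ![1, 1, -1, -1]

/-- J₁ : e₁↦e₂, e₂↦−e₁, e₃↦−e₄, e₄↦e₃. -/
def J1 (x : V) : V := ![-x 1, x 0, x 3, -x 2]

/-- J₂ : e₁↦e₃, e₂↦e₄, e₃↦−e₁, e₄↦−e₂. -/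
def J2 (x : V) : V := ![-x 2, -x 3, x 0, x 1]

/-- J₃ : e₁↦−e₄, e₂↦e₃, e₃↦−e₂, e₄↦e₁. -/
def J3 (x : V) : V := ![x 3, -x 2, x 1, -x 0]

/-- Lie bracket of 𝔤₄,₇ : [e₁,e₄]=2e₁, [e₂,e₃]=e₁, [e₂,e₄]=e₂, [e₃,e₄]=e₂+e₃. -/
def br (x y : V) : V :=
  ![2 * (x 0 * y 3 - x 3 * y 0) + (x 1 * y 2 - x 2 * y 1),
    (x 1 * y 3 - x 3 * y 1) + (x 2 * y 3 - x 3 * y 2),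
    x 2 * y 3 - x 3 * y 2, 0]

/-- Fundamental tensor F(x,y,z) = g((∇ₓ J)y, z) for an almost complex structure Jm. -/
def Fa (nab : V →ₗ[ℝ] V →ₗ[ℝ] V) (Jm : V → V) (x y z : V) : ℝ :=
  gm (nab x (Jm y) - Jm (nab x y)) z

/-- Lee form θ(z) = Σᵢ εᵢ F(eᵢ,eᵢ,z). -/
def theta (nab : V →ₗ[ℝ] V →ₗ[ℝ] V) (Jm : V → V) : V → ℝ :=
  fun z => ∑ i, eps i * Fa nab Jm (e i) (e i) z

/-- Curvature operator R(x,y)z = ∇ₓ∇_y z − ∇_y∇ₓ z − ∇_{[x,y]} z. -/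
def Rm (nab : V →ₗ[ℝ] V →ₗ[ℝ] V) (x y z : V) : V :=
  nab x (nab y z) - nab y (nab x z) - nab (br x y) z

/-- Curvature (0,4)-tensor R(x,y,z,w) = g(R(x,y)z, w). -/
def R4 (nab : V →ₗ[ℝ] V →ₗ[ℝ] V) (x y z w : V) : ℝ := gm (Rm nab x y z) w

/-- Ricci tensor ρ(y,z) = Σᵢ εᵢ R(eᵢ,y,z,eᵢ). -/
def ricci (nab : V →ₗ[ℝ] V →ₗ[ℝ] V) (y z : V) : ℝ :=
  ∑ i, eps i * R4 nab (e i) y z (e i)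

/-- Scalar curvature τ = Σⱼ εⱼ ρ(eⱼ,eⱼ). -/
def tau (nab : V →ₗ[ℝ] V →ₗ[ℝ] V) : ℝ := ∑ j, eps j * ricci nab (e j) (e j)

/-- Associated Ricci tensor ρ*(y,z) = Σᵢ εᵢ R(eᵢ,y,z,J eᵢ). -/
def ricciS (nab : V →ₗ[ℝ] V →ₗ[ℝ] V) (Jm : V → V) (y z : V) : ℝ :=
  ∑ i, eps i * R4 nab (e i) y z (Jm (e i))

/-- ∗-scalar curvature τ* = Σⱼ εⱼ ρ*(eⱼ,eⱼ). -/
def tauS (nab : V →ₗ[ℝ] V →ₗ[ℝ] V) (Jm : V → V) : ℝ :=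
  ∑ j, eps j * ricciS nab Jm (e j) (e j)

/-- ∗∗-scalar curvature τ** = Σⱼ εⱼ ρ*(eⱼ,J eⱼ). -/
def tauSS (nab : V →ₗ[ℝ] V →ₗ[ℝ] V) (Jm : V → V) : ℝ :=
  ∑ j, eps j * ricciS nab Jm (e j) (Jm (e j))

/-- Basic sectional curvature k_{ij} = R(eᵢ,eⱼ,eⱼ,eᵢ)/(εᵢεⱼ). -/
def sek (nab : V →ₗ[ℝ] V →ₗ[ℝ] V) (i j : Fin 4) : ℝ :=
  R4 nab (e i) (e j) (e j) (e i) / (eps i * eps j)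

/-- Antisymmetrized Kronecker symbol used to encode curvature-type tensors. -/
def D (a b i j : Fin 4) : ℝ :=
  (if i = a ∧ j = b then (1 : ℝ) else 0) - (if i = b ∧ j = a then (1 : ℝ) else 0)

/-- The Levi-Civita connection in coordinates, solved from the Koszul formula. -/
theorem koszul_coords (nab : V →ₗ[ℝ] V →ₗ[ℝ] V)
    (hK : ∀ x y z : V, 2 * gm (nab x y) z = gm (br x y) z + gm (br z x) y + gm (br z y) x)
    (x y : V) :
    nab x y 0 = (gm (br x y) (e 0) + gm (br (e 0) x) y + gm (br (e 0) y) x) / 2 ∧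
    nab x y 1 = (gm (br x y) (e 1) + gm (br (e 1) x) y + gm (br (e 1) y) x) / 2 ∧
    nab x y 2 = -(gm (br x y) (e 2) + gm (br (e 2) x) y + gm (br (e 2) y) x) / 2 ∧
    nab x y 3 = -(gm (br x y) (e 3) + gm (br (e 3) x) y + gm (br (e 3) y) x) / 2 := by
  simp only [← hK]
  simp [gm, e]

/-- The fundamental tensor of `J1` in coordinates. -/
theorem Fa_J1_eq (nab : V →ₗ[ℝ] V →ₗ[ℝ] V)
    (hK : ∀ x y z : V, 2 * gm (nab x y) z = gm (br x y) z + gm (br z x) y + gm (br z y) x)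
    (x y z : V) :
    Fa nab J1 x y z =
      (1/2) * (gm x y * (z 1 + 3 * z 2) - gm x (J1 y) * (J1 z 1 + 3 * J1 z 2)
        - gm x z * (y 1 + 3 * y 2) + gm x (J1 z) * (J1 y 1 + 3 * J1 y 2)) := by
  obtain ⟨h0, h1, h2, h3⟩ := koszul_coords nab hK x y
  obtain ⟨k0, k1, k2, k3⟩ := koszul_coords nab hK x (J1 y)
  have hFa : Fa nab J1 x y z =
      (nab x (J1 y) 0 + nab x y 1) * z 0 + (nab x (J1 y) 1 - nab x y 0) * z 1
        - (nab x (J1 y) 2 - nab x y 3) * z 2 - (nab x (J1 y) 3 + nab x y 2) * z 3 := by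
    simp [Fa, gm, J1]
  rw [hFa, h0, h1, h2, h3, k0, k1, k2, k3]
  simp [gm, br, e, J1]
  ring

/-- The Lee form of `J1` in coordinates. -/
theorem theta_J1_eq (nab : V →ₗ[ℝ] V →ₗ[ℝ] V)
    (hK : ∀ x y z : V, 2 * gm (nab x y) z = gm (br x y) z + gm (br z x) y + gm (br z y) x)
    (z : V) : theta nab J1 z = z 1 + 3 * z 2 := by
  simp only [theta, Fa_J1_eq nab hK]
  simp [Fin.sum_univ_four, eps, gm, e, J1]
  ring

theorem stmt_12
    (nab : V →ₗ[ℝ] V →ₗ[ℝ] V)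
    (hK : ∀ x y z : V, 2 * gm (nab x y) z = gm (br x y) z + gm (br z x) y + gm (br z y) x) :
    (∀ x y z : V, Fa nab J1 x y z =
      (1/2) * (gm x y * theta nab J1 z - gm x (J1 y) * theta nab J1 (J1 z)
        - gm x z * theta nab J1 y + gm x (J1 z) * theta nab J1 (J1 y))) ∧
    theta nab J1 (e 1) = 1 ∧ theta nab J1 (e 2) = 3 ∧
    theta nab J1 (e 0) = 0 ∧ theta nab J1 (e 3) = 0 ∧
    theta nab J1 ≠ 0
  := by
    have hθ := theta_J1_eq nab hK
    have h1 : theta nab J1 (e 1) = 1 := by simp [hθ, e]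
    refine ⟨fun x y z => ?_, h1, ?_, ?_, ?_, fun h => ?_⟩
    · simp only [hθ, Fa_J1_eq nab hK x y z]
    · simp [hθ, e]
    · simp [hθ, e]
    · simp [hθ, e]
    · simp [h] at h1
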